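/- arXiv:1808.05694 — 6 statements merged into one kernel-verified Lean document; each statement's English description precedes it below -/
import Mathlib

section
/- Every 2-dimensional subalgebra 𝔥 of g = sl(1|1) is ℤ₂-graded; that is, 𝔥 = (𝔥 ∩ g_0̄) ⊕ (𝔥 ∩ g_1̄). -/
/-!
STATEMENT 1. `g = sl(1|1)` is modeled as `k × k × k` with coordinates recording the
coefficients of the basis `e, f, h`; so `e = (1,0,0)`, `f = (0,1,0)`, `h = (0,0,1)`.
The even part is `g₀ = k·h`, the odd part is `g₁ = k·e ⊕ k·f`.
Every 2-dimensional subalgebra of `g` is ℤ₂-graded: `𝔥 = (𝔥 ⊓ g₀) ⊔ (𝔥 ⊓ g₁)`.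
-/

/-- The superbracket of `sl(1|1)` in coordinates `(e-coeff, f-coeff, h-coeff)`. -/
def sl11Bracket {k : Type} [Field k] (x y : k × k × k) : k × k × k :=
  (0, 0, x.1 * y.2.1 + y.1 * x.2.1)

theorem stmt1 (k : Type) [Field k] [IsAlgClosed k] (hchar : (2 : k) ≠ 0)
    (𝔥 : Submodule k (k × k × k)) (hdim : Module.finrank k 𝔥 = 2)
    (hsub : ∀ x ∈ 𝔥, ∀ y ∈ 𝔥, sl11Bracket x y ∈ 𝔥) :
    𝔥 = (𝔥 ⊓ Submodule.span k {((0 : k), (0 : k), (1 : k))}) ⊔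
        (𝔥 ⊓ Submodule.span k {((1 : k), (0 : k), (0 : k)), ((0 : k), (1 : k), (0 : k))}) := by
  by_cases hh : ((0 : k), (0 : k), (1 : k)) ∈ 𝔥
  · apply le_antisymm _ (sup_le inf_le_left inf_le_left)
    rintro ⟨a, b, c⟩ hx
    have h1 : ((0 : k), (0 : k), c) ∈ 𝔥 := by
      simpa using 𝔥.smul_mem c hh
    have h2 : (a, b, (0 : k)) ∈ 𝔥 := by
      simpa using 𝔥.sub_mem hx h1
    refine Submodule.mem_sup.2 ⟨(0, 0, c), ⟨h1, ?_⟩, (a, b, 0), ⟨h2, ?_⟩, by simp⟩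
    · exact Submodule.mem_span_singleton.2 ⟨c, by simp⟩
    · exact Submodule.mem_span_pair.2 ⟨a, b, by simp⟩
  · exfalso
    have hz : ∀ c : k, ((0 : k), (0 : k), c) ∈ 𝔥 → c = 0 := by
      intro c hc
      by_contra hne
      apply hh
      simpa [hne] using 𝔥.smul_mem c⁻¹ hc
    have hB := (Module.finBasisOfFinrankEq k 𝔥 hdim).linearIndependent
    generalize (⇑(Module.finBasisOfFinrankEq k 𝔥 hdim)) = B at hB
    have hB' := LinearIndependent.pair_iff.1 (show LinearIndependent k ![B 0, B 1] by
      convert hB using 1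
      ext i : 1
      fin_cases i <;> rfl)
    generalize B 0 = u at hB'
    generalize B 1 = v at hB'
    obtain ⟨⟨a, b, c⟩, hu⟩ := u
    obtain ⟨⟨a', b', c'⟩, hv⟩ := v
    have e1 := hz _ (hsub _ hu _ hu)
    have e2 := hz _ (hsub _ hv _ hv)
    have e3 := hz _ (hsub _ hu _ hv)
    simp only at e1 e2 e3
    have f1 : a * b = 0 := by
      have : 2 * (a * b) = 0 := by linear_combination e1
      simpa [hchar] using this
    have key : ∀ s t : k, s * a + t * a' = 0 → s * b + t * b' = 0 → s = 0 ∧ t = 0 := by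
      intro s t h1 h2
      apply hB'
      have hm := 𝔥.add_mem (𝔥.smul_mem s hu) (𝔥.smul_mem t hv)
      have h3 : s * c + t * c' = 0 := by
        apply hz
        simpa [h1, h2] using hm
      ext <;> simp [h1, h2, h3]
    have g1 : a * b' = 0 := by
      have : (a * b') ^ 2 = 0 := by
        linear_combination (a * b') * e3 - a' * b' * f1
      simpa using this
    have g2 : a' * b = 0 := by linear_combination e3 - g1
    have k1 := key a' (-a) (by ring) (by linear_combination g2 - g1)
    have k2 := key b' (-b) (by linear_combination g1 - g2) (by ring)
    have ha : a = 0 := by simpa using k1.2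
    have hb : b = 0 := by simpa using k2.2
    have := key 1 0 (by simp [ha]) (by simp [hb])
    exact one_ne_zero this.1
end

section
/- Let 𝔥 = k·h ⊕ k·(αe + βf) with (α,β) ∈ k² \ {(0,0)}, let φ ∈ 𝔥*, and set λ = φ(h), γ = φ(αe + βf). Then φ determines a 1-dimensional 𝔥-module (via a·y = φ(a)y) if and only if γ² = αβλ. Precisely: (i) there exists a unital k-algebra homomorphism from k⟨H,V⟩/⟨HV − VH, V² − αβH⟩ to k sending H ↦ λ and V ↦ γ if and only if γ² = αβλ; and (ii) the cyclic left U(g)-module U(g)/(U(g)(h − λ) + U(g)(αe + βf − γ)) is nonzero if and only if γ² = αβλ. -/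
/-!
STATEMENT 2. Let `𝔥 = k·h ⊕ k·(αe + βf)` be a 2-dimensional subalgebra of `sl(1|1)`,
`φ ∈ 𝔥*`, `lam = φ(h)`, `gam = φ(αe + βf)`.  Then `φ` determines a 1-dimensional
`𝔥`-module iff `gam² = αβ·lam`.  Precisely:
(i) there is a unital `k`-algebra homomorphism `k⟨H,V⟩/⟨HV − VH, V² − αβH⟩ → k`
    with `H ↦ lam`, `V ↦ gam` iff `gam² = αβ·lam`;  (generator `0 = H`, `1 = V`)
(ii) the cyclic left `U(g)`-module `U(g)/(U(g)(h − lam) + U(g)(αe + βf − gam))` is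
    nonzero iff `gam² = αβ·lam`, where `U(g) = k⟨e,f,h⟩/⟨ef+fe−h, he−eh, hf−fh, e², f²⟩`
    (generators `0 = e`, `1 = f`, `2 = h`).
-/

/-- Relations of `k⟨H,V⟩/⟨HV − VH, V² − αβH⟩` (the enveloping algebra of `𝔥`). -/
inductive UhRel (k : Type) [Field k] (α β : k) :
    FreeAlgebra k (Fin 2) → FreeAlgebra k (Fin 2) → Prop
  | comm : UhRel k α β (FreeAlgebra.ι k 0 * FreeAlgebra.ι k 1)
      (FreeAlgebra.ι k 1 * FreeAlgebra.ι k 0)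
  | sq : UhRel k α β (FreeAlgebra.ι k 1 * FreeAlgebra.ι k 1) ((α * β) • FreeAlgebra.ι k 0)

/-- `U(𝔥) = k⟨H,V⟩/⟨HV − VH, V² − αβH⟩`. -/
abbrev Uh (k : Type) [Field k] (α β : k) := RingQuot (UhRel k α β)

/-- Relations of the enveloping algebra of `sl(1|1)`: generators `0 = e, 1 = f, 2 = h`. -/
inductive Usl11Rel (k : Type) [Field k] :
    FreeAlgebra k (Fin 3) → FreeAlgebra k (Fin 3) → Prop
  | ef : Usl11Rel k (FreeAlgebra.ι k 0 * FreeAlgebra.ι k 1 + FreeAlgebra.ι k 1 * FreeAlgebra.ι k 0)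
      (FreeAlgebra.ι k 2)
  | he : Usl11Rel k (FreeAlgebra.ι k 2 * FreeAlgebra.ι k 0) (FreeAlgebra.ι k 0 * FreeAlgebra.ι k 2)
  | hf : Usl11Rel k (FreeAlgebra.ι k 2 * FreeAlgebra.ι k 1) (FreeAlgebra.ι k 1 * FreeAlgebra.ι k 2)
  | ee : Usl11Rel k (FreeAlgebra.ι k 0 * FreeAlgebra.ι k 0) 0
  | ff : Usl11Rel k (FreeAlgebra.ι k 1 * FreeAlgebra.ι k 1) 0

/-- `U(g)` for `g = sl(1|1)`. -/
abbrev Usl11 (k : Type) [Field k] := RingQuot (Usl11Rel k)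

/-- The images of the generators `e, f, h` in `U(g)`. -/
def genU (k : Type) [Field k] (i : Fin 3) : Usl11 k :=
  RingQuot.mkAlgHom k (Usl11Rel k) (FreeAlgebra.ι k i)

/-- A representation with a nonzero common eigenvector shows the left ideal is proper. -/
theorem span_ne_top_aux (k : Type) [Field k] (α β lam gam : k)
    (E F : Matrix (Fin 2) (Fin 2) k) (v : Fin 2 → k) (hv : v ≠ 0)
    (hEE : E * E = 0) (hFF : F * F = 0) (hEF : E * F + F * E = lam • 1)
    (hV : (α • E + β • F).mulVec v = gam • v) :
    Submodule.span (Usl11 k)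
        {genU k 2 - algebraMap k (Usl11 k) lam,
         α • genU k 0 + β • genU k 1 - algebraMap k (Usl11 k) gam} ≠ ⊤ := by
  let ρ : Usl11 k →ₐ[k] Matrix (Fin 2) (Fin 2) k :=
    RingQuot.liftAlgHom k ⟨FreeAlgebra.lift k ![E, F, lam • 1], by
      intro x y hxy
      cases hxy <;> simp [hEE, hFF, hEF]⟩
  have h0 : ρ (genU k 0) = E := by simp [ρ, genU]
  have h1 : ρ (genU k 1) = F := by simp [ρ, genU]
  have h2 : ρ (genU k 2) = lam • 1 := by simp [ρ, genU]
  intro htop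
  have key : ∀ u ∈ Submodule.span (Usl11 k)
        {genU k 2 - algebraMap k (Usl11 k) lam,
         α • genU k 0 + β • genU k 1 - algebraMap k (Usl11 k) gam}, (ρ u).mulVec v = 0 := by
    intro u hu
    induction hu using Submodule.span_induction with
    | mem x hx =>
      rcases hx with rfl | hx
      · rw [map_sub, h2, AlgHom.commutes, Algebra.algebraMap_eq_smul_one, sub_self,
          Matrix.zero_mulVec]
      · rw [Set.mem_singleton_iff.1 hx, map_sub, map_add, map_smul, map_smul, h0, h1,
          AlgHom.commutes, Algebra.algebraMap_eq_smul_one, Matrix.sub_mulVec, hV,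
          Matrix.smul_mulVec, Matrix.one_mulVec, sub_self]
    | zero => simp
    | add x y _ _ hx hy => rw [map_add, Matrix.add_mulVec, hx, hy, add_zero]
    | smul a x _ hx =>
      rw [smul_eq_mul, map_mul, ← Matrix.mulVec_mulVec, hx, Matrix.mulVec_zero]
  have := key 1 (by rw [htop]; trivial)
  rw [map_one, Matrix.one_mulVec] at this
  exact hv this

theorem V_sq_aux (k : Type) [Field k] (α β : k) :
    (α • genU k 0 + β • genU k 1) * (α • genU k 0 + β • genU k 1) = (α * β) • genU k 2 := by
  have hee : genU k 0 * genU k 0 = 0 := by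
    have := RingQuot.mkAlgHom_rel k (Usl11Rel.ee (k := k))
    simpa [genU] using this
  have hff : genU k 1 * genU k 1 = 0 := by
    have := RingQuot.mkAlgHom_rel k (Usl11Rel.ff (k := k))
    simpa [genU] using this
  have hef : genU k 0 * genU k 1 + genU k 1 * genU k 0 = genU k 2 := by
    have := RingQuot.mkAlgHom_rel k (Usl11Rel.ef (k := k))
    simpa [genU] using this
  rw [← hef]
  simp only [add_mul, mul_add, smul_mul_smul_comm, hee, hff, smul_zero, smul_add, mul_comm β α]
  abel

theorem stmt2 (k : Type) [Field k] [IsAlgClosed k] (hchar : (2 : k) ≠ 0)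
    (α β lam gam : k) (hαβ : (α, β) ≠ (0, 0)) :
    ((∃ ψ : Uh k α β →ₐ[k] k,
        ψ (RingQuot.mkAlgHom k (UhRel k α β) (FreeAlgebra.ι k 0)) = lam ∧
        ψ (RingQuot.mkAlgHom k (UhRel k α β) (FreeAlgebra.ι k 1)) = gam) ↔
      gam ^ 2 = α * β * lam) ∧
    ((Submodule.span (Usl11 k)
        {genU k 2 - algebraMap k (Usl11 k) lam,
         α • genU k 0 + β • genU k 1 - algebraMap k (Usl11 k) gam} ≠ ⊤) ↔
      gam ^ 2 = α * β * lam) := by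
  constructor
  · constructor
    · rintro ⟨ψ, h0, h1⟩
      have := congrArg ψ (RingQuot.mkAlgHom_rel k (UhRel.sq (k := k) (α := α) (β := β)))
      rw [map_mul, map_mul, map_smul, map_smul, h0, h1] at this
      rw [pow_two, this, smul_eq_mul]
    · intro h
      refine ⟨RingQuot.liftAlgHom k ⟨FreeAlgebra.lift k ![lam, gam], ?_⟩, ?_, ?_⟩
      · intro x y hxy
        cases hxy
        · simp [mul_comm]
        · simp [← h, pow_two]
      · simp
      · simp
  · constructor
    · intro hne
      by_contra hcon
      apply hne
      set S := Submodule.span (Usl11 k)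
        {genU k 2 - algebraMap k (Usl11 k) lam,
         α • genU k 0 + β • genU k 1 - algebraMap k (Usl11 k) gam} with hS
      have m1 : genU k 2 - algebraMap k (Usl11 k) lam ∈ S :=
        Submodule.subset_span (by simp)
      have m2 : α • genU k 0 + β • genU k 1 - algebraMap k (Usl11 k) gam ∈ S :=
        Submodule.subset_span (by simp)
      have hd : gam ^ 2 - α * β * lam ≠ 0 := sub_ne_zero.2 hcon
      have m3 := S.sub_mem (S.smul_mem (algebraMap k (Usl11 k) (α * β)) m1)
        (S.smul_mem (α • genU k 0 + β • genU k 1 + algebraMap k (Usl11 k) gam) m2)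
      have e : algebraMap k (Usl11 k) (α * β) • (genU k 2 - algebraMap k (Usl11 k) lam) -
          (α • genU k 0 + β • genU k 1 + algebraMap k (Usl11 k) gam) •
          (α • genU k 0 + β • genU k 1 - algebraMap k (Usl11 k) gam) =
          algebraMap k (Usl11 k) (gam ^ 2 - α * β * lam) := by
        have hsq := V_sq_aux k α β
        generalize α • genU k 0 + β • genU k 1 = V at hsq ⊢
        have hc := Algebra.commutes gam V
        rw [Algebra.smul_def] at hsq
        simp only [smul_eq_mul, mul_sub, add_mul, hsq, hc, map_sub, map_mul, map_pow, pow_two]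
        abel
      rw [e] at m3
      have m4 := S.smul_mem (algebraMap k (Usl11 k) (gam ^ 2 - α * β * lam)⁻¹) m3
      rw [smul_eq_mul, ← map_mul, inv_mul_cancel₀ hd, map_one] at m4
      exact (Ideal.eq_top_iff_one S).2 m4
    · intro h
      by_cases hβ : β = 0
      · have hα : α ≠ 0 := by
          rintro rfl
          exact hαβ (by rw [hβ])
        refine span_ne_top_aux k α β lam gam !![0, 0; 1, 0] !![0, lam; 0, 0] ![gam, α] ?_ ?_ ?_ ?_ ?_
        · intro h0
          exact hα (by simpa using congrFun h0 1)
        · ext i j; fin_cases i <;> fin_cases j <;> simp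
        · ext i j; fin_cases i <;> fin_cases j <;> simp
        · ext i j; fin_cases i <;> fin_cases j <;> simp
        · ext i; fin_cases i <;> simp [Matrix.mulVec, dotProduct, Fin.sum_univ_two]
          · linear_combination -h
          · ring
      · refine span_ne_top_aux k α β lam gam !![0, lam; 0, 0] !![0, 0; 1, 0] ![gam, β] ?_ ?_ ?_ ?_ ?_
        · intro h0
          exact hβ (by simpa using congrFun h0 1)
        · ext i j; fin_cases i <;> fin_cases j <;> simp
        · ext i j; fin_cases i <;> fin_cases j <;> simp
        · ext i j; fin_cases i <;> fin_cases j <;> simp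
        · ext i; fin_cases i <;> simp [Matrix.mulVec, dotProduct, Fin.sum_univ_two]
          · linear_combination -h
          · ring
end

section
/- A 2-dimensional k-subspace 𝔥 of the color Lie algebra g = sl₂^c(k) is a subalgebra (i.e., is closed under the color bracket) if and only if 𝔥 = k·a_i ⊕ k·(a_j + μ a_k) for some choice of distinct indices with {i, j, k} = {1, 2, 3} and some μ ∈ {1, −1}. -/
noncomputable section

/-- The color Lie algebra `sl₂ᶜ(k)` modeled as `k × k × k`, coordinates recording the
coefficients of the basis `a₁, a₂, a₃`.  The symmetric bilinear color bracket is determined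
by `⟨a_i, a_j⟩ = a_k` whenever `{i,j,k} = {1,2,3}` and `⟨a_i, a_i⟩ = 0`. -/
def colorBracket {k : Type} [Field k] (x y : k × k × k) : k × k × k :=
  (x.2.1 * y.2.2 + x.2.2 * y.2.1, x.2.2 * y.1 + x.1 * y.2.2, x.1 * y.2.1 + x.2.1 * y.1)

/-- The basis `a₁, a₂, a₃` (indexed by `Fin 3`). -/
def aBasis (k : Type) [Field k] : Fin 3 → k × k × k :=
  ![(1, 0, 0), (0, 1, 0), (0, 0, 1)]

theorem plane_eq (k : Type) [Field k]
    (𝔥 : Submodule k (k × k × k)) (hdim : Module.finrank k 𝔥 = 2) :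
    ∃ α β γ : k, (α ≠ 0 ∨ β ≠ 0 ∨ γ ≠ 0) ∧
      ∀ x y z : k, (x, y, z) ∈ 𝔥 ↔ α * x + β * y + γ * z = 0 := by
  have hV : Module.finrank k (k × k × k) = 3 := by simp
  have hlt : 𝔥 < ⊤ := by
    rw [lt_top_iff_ne_top]
    rintro rfl
    rw [finrank_top, hV] at hdim
    omega
  obtain ⟨f, hf, hle⟩ := Submodule.exists_le_ker_of_lt_top 𝔥 hlt
  have hfin : Module.finrank k (LinearMap.ker f) = 2 := by
    have h1 := LinearMap.finrank_range_add_finrank_ker f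
    have h2 : LinearMap.range f = ⊤ := LinearMap.range_eq_top.2 (LinearMap.surjective hf)
    rw [h2, finrank_top, hV, Module.finrank_self] at h1
    omega
  have heq : 𝔥 = LinearMap.ker f := Submodule.eq_of_le_of_finrank_eq hle (by rw [hdim, hfin])
  have hval : ∀ x y z : k, f (x, y, z) = f (1, 0, 0) * x + f (0, 1, 0) * y + f (0, 0, 1) * z := by
    intro x y z
    have : ((x, y, z) : k × k × k) = x • (1, 0, 0) + y • (0, 1, 0) + z • (0, 0, 1) := by simp
    rw [this, map_add, map_add, map_smul, map_smul, map_smul]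
    simp only [smul_eq_mul]
    ring
  refine ⟨f (1, 0, 0), f (0, 1, 0), f (0, 0, 1), ?_, ?_⟩
  · by_contra! h
    obtain ⟨h1, h2, h3⟩ := h
    apply hf
    refine LinearMap.ext fun v => ?_
    obtain ⟨x, y, z⟩ := v
    rw [hval, h1, h2, h3]
    simp
  · intro x y z
    rw [heq, LinearMap.mem_ker, hval]

theorem stmt10 (k : Type) [Field k] [IsAlgClosed k] [CharZero k]
    (𝔥 : Submodule k (k × k × k)) (hdim : Module.finrank k 𝔥 = 2) :
    (∀ x ∈ 𝔥, ∀ y ∈ 𝔥, colorBracket x y ∈ 𝔥) ↔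
      ∃ (i j l : Fin 3) (μ : k), i ≠ j ∧ j ≠ l ∧ i ≠ l ∧ (μ = 1 ∨ μ = -1) ∧
        𝔥 = Submodule.span k {aBasis k i, aBasis k j + μ • aBasis k l} := by
  constructor
  · intro H
    obtain ⟨α, β, γ, hne, hmem⟩ := plane_eq k 𝔥 hdim
    have hbr : ∀ x y z x' y' z' : k, α * x + β * y + γ * z = 0 → α * x' + β * y' + γ * z' = 0 →
        α * (y * z' + z * y') + β * (z * x' + x * z') + γ * (x * y' + y * x') = 0 := by
      intro x y z x' y' z' h h'
      exact (hmem _ _ _).1 (H _ ((hmem _ _ _).2 h) _ ((hmem _ _ _).2 h'))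
    have h0 : α * β * γ = 0 := by
      have h1 := hbr β (-α) 0 β (-α) 0 (by ring) (by ring)
      have h2 : (2 : k) * (α * β * γ) = 0 := by linear_combination -h1
      simpa using h2
    have key : ∀ i j l : Fin 3, ∀ s : k, i ≠ j → j ≠ l → i ≠ l → (s = 1 ∨ s = -1) →
        (∀ x y z : k, (x, y, z) ∈ 𝔥 ↔
          ∃ a b : k, a • aBasis k i + b • (aBasis k j + s • aBasis k l) = (x, y, z)) →
        ∃ (i j l : Fin 3) (μ : k), i ≠ j ∧ j ≠ l ∧ i ≠ l ∧ (μ = 1 ∨ μ = -1) ∧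
        𝔥 = Submodule.span k {aBasis k i, aBasis k j + μ • aBasis k l} := by
      intro i j l s h1 h2 h3 hs h
      refine ⟨i, j, l, s, h1, h2, h3, hs, ?_⟩
      ext ⟨x, y, z⟩
      rw [h, Submodule.mem_span_pair]
    have hz : α = 0 ∨ β = 0 ∨ γ = 0 := by grind
    rcases hz with rfl | rfl | rfl
    · have h1 := hbr 1 0 0 0 γ (-β) (by ring) (by ring)
      have h2 : γ = β ∨ γ = -β := sq_eq_sq_iff_eq_or_eq_neg.1 (by linear_combination h1)
      obtain ⟨s, hs, hγ⟩ : ∃ s : k, (s = 1 ∨ s = -1) ∧ β = - s * γ := by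
        rcases h2 with h | h
        · exact ⟨-1, by simp, by simp [h]⟩
        · exact ⟨1, by simp, by simp [h]⟩
      refine key 0 2 1 (s) (by decide) (by decide) (by decide) hs fun x y z => ?_
      rw [hmem]
      simp only [aBasis, Matrix.cons_val, Prod.smul_mk, Prod.mk_add_mk, Prod.mk.injEq, smul_eq_mul]
      constructor
      · intro h
        refine ⟨x, z, ?_, ?_, ?_⟩ <;> grind
      · rintro ⟨a, b, h1, h2, h3⟩
        grind
    · have h1 := hbr 0 1 0 γ 0 (-α) (by ring) (by ring)
      have h2 : γ = α ∨ γ = -α := sq_eq_sq_iff_eq_or_eq_neg.1 (by linear_combination h1)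
      obtain ⟨s, hs, hγ⟩ : ∃ s : k, (s = 1 ∨ s = -1) ∧ α = - s * γ := by
        rcases h2 with h | h
        · exact ⟨-1, by simp, by simp [h]⟩
        · exact ⟨1, by simp, by simp [h]⟩
      refine key 1 2 0 (s) (by decide) (by decide) (by decide) hs fun x y z => ?_
      rw [hmem]
      simp only [aBasis, Matrix.cons_val, Prod.smul_mk, Prod.mk_add_mk, Prod.mk.injEq, smul_eq_mul]
      constructor
      · intro h
        refine ⟨y, z, ?_, ?_, ?_⟩ <;> grind
      · rintro ⟨a, b, h1, h2, h3⟩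
        grind
    · have h1 := hbr 0 0 1 β (-α) 0 (by ring) (by ring)
      have h2 : β = α ∨ β = -α := sq_eq_sq_iff_eq_or_eq_neg.1 (by linear_combination h1)
      obtain ⟨s, hs, hγ⟩ : ∃ s : k, (s = 1 ∨ s = -1) ∧ α = - s * β := by
        rcases h2 with h | h
        · exact ⟨-1, by simp, by simp [h]⟩
        · exact ⟨1, by simp, by simp [h]⟩
      refine key 2 1 0 (s) (by decide) (by decide) (by decide) hs fun x y z => ?_
      rw [hmem]
      simp only [aBasis, Matrix.cons_val, Prod.smul_mk, Prod.mk_add_mk, Prod.mk.injEq, smul_eq_mul]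
      constructor
      · intro h
        refine ⟨z, y, ?_, ?_, ?_⟩ <;> grind
      · rintro ⟨a, b, h1, h2, h3⟩
        grind
  · rintro ⟨i, j, l, μ, hij, hjl, hil, hμ, rfl⟩ x hx y hy
    have hμ2 : μ * μ = 1 := by rcases hμ with rfl | rfl <;> ring
    rw [Submodule.mem_span_pair] at hx hy ⊢
    obtain ⟨a, b, rfl⟩ := hx
    obtain ⟨c, d, rfl⟩ := hy
    -- bracket of `a a_i + b (a_j + μ a_l)` and `c a_i + d (a_j + μ a_l)`
    refine ⟨2 * μ * b * d, μ * (a * d + b * c), ?_⟩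
    fin_cases i <;> fin_cases j <;> first | exact absurd rfl hij | skip
    all_goals fin_cases l <;> first | exact absurd rfl hjl | exact absurd rfl hil | skip
    all_goals
      simp [aBasis, colorBracket]
      try grind
end
end

section
/- No 2-dimensional subalgebra of the color Lie algebra g = sl₂^c(k) is G-graded, where G = ℤ₂ × ℤ₂: if 𝔥 is a 2-dimensional k-subspace of g closed under the color bracket, then 𝔥 ≠ ⊕_{α∈G} (𝔥 ∩ g_α). -/
noncomputable section

/-- The `G = ℤ₂ × ℤ₂` grading of `sl₂ᶜ(k)`: `g_{(0,0)} = 0`, `g_{(1,0)} = k·a₁`,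
`g_{(0,1)} = k·a₂`, `g_{(1,1)} = k·a₃`. -/
def gPiece (k : Type) [Field k] (α : ZMod 2 × ZMod 2) : Submodule k (k × k × k) :=
  if α = (1, 0) then Submodule.span k {aBasis k 0}
  else if α = (0, 1) then Submodule.span k {aBasis k 1}
  else if α = (1, 1) then Submodule.span k {aBasis k 2}
  else ⊥

theorem inf_span_le_aux {k : Type} [Field k] (h : Submodule k (k × k × k)) (i j : Fin 3)
    (hij : aBasis k j ∈ h → j = i) :
    h ⊓ Submodule.span k {aBasis k j} ≤ Submodule.span k {aBasis k i} := by
  rintro x ⟨hx, hx'⟩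
  obtain ⟨c, rfl⟩ := Submodule.mem_span_singleton.1 hx'
  by_cases hc : c = 0
  · simp [hc]
  · have : aBasis k j ∈ h := (Submodule.smul_mem_iff h hc).1 hx
    rw [← hij this]
    exact Submodule.smul_mem _ _ (Submodule.mem_span_singleton_self _)

/-- No 2-dimensional subalgebra of `sl₂ᶜ(k)` is `G`-graded, `G = ℤ₂ × ℤ₂`. -/
theorem stmt11 (k : Type) [Field k] [IsAlgClosed k] [CharZero k]
    (𝔥 : Submodule k (k × k × k)) (hdim : Module.finrank k 𝔥 = 2)
    (hsub : ∀ x ∈ 𝔥, ∀ y ∈ 𝔥, colorBracket x y ∈ 𝔥) :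
    𝔥 ≠ ⨆ α : ZMod 2 × ZMod 2, 𝔥 ⊓ gPiece k α := by
  intro heq
  by_cases hex : ∃ i : Fin 3, ∀ j, aBasis k j ∈ 𝔥 → j = i
  · obtain ⟨i, hi⟩ := hex
    have hle : 𝔥 ≤ Submodule.span k {aBasis k i} := by
      rw [heq]
      refine iSup_le fun α => ?_
      unfold gPiece
      split_ifs
      · exact inf_span_le_aux 𝔥 i 0 (hi 0)
      · exact inf_span_le_aux 𝔥 i 1 (hi 1)
      · exact inf_span_le_aux 𝔥 i 2 (hi 2)
      · simp
    have h1 := Submodule.finrank_mono hle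
    have h2 := finrank_span_le_card (R := k) ({aBasis k i} : Set (k × k × k))
    simp at h2
    omega
  · have h01 : aBasis k 0 ∈ 𝔥 → aBasis k 1 ∈ 𝔥 → aBasis k 2 ∈ 𝔥 := fun h h' => by
      simpa [colorBracket, aBasis] using hsub _ h _ h'
    have h02 : aBasis k 0 ∈ 𝔥 → aBasis k 2 ∈ 𝔥 → aBasis k 1 ∈ 𝔥 := fun h h' => by
      simpa [colorBracket, aBasis] using hsub _ h _ h'
    have h12 : aBasis k 1 ∈ 𝔥 → aBasis k 2 ∈ 𝔥 → aBasis k 0 ∈ 𝔥 := fun h h' => by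
      simpa [colorBracket, aBasis] using hsub _ h _ h'
    have hall : aBasis k 0 ∈ 𝔥 ∧ aBasis k 1 ∈ 𝔥 ∧ aBasis k 2 ∈ 𝔥 := by
      push Not at hex
      have e0 := hex 0
      have e1 := hex 1
      have e2 := hex 2
      simp only [Fin.exists_fin_succ, Fin.exists_fin_zero] at e0 e1 e2
      simp at e0 e1 e2
      tauto
    obtain ⟨m0, m1, m2⟩ := hall
    have htop : 𝔥 = ⊤ := by
      rw [eq_top_iff]
      rintro ⟨a, b, c⟩ -
      have := 𝔥.add_mem (𝔥.add_mem (𝔥.smul_mem a m0) (𝔥.smul_mem b m1)) (𝔥.smul_mem c m2)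
      simpa [aBasis] using this
    rw [htop, finrank_top] at hdim
    simp at hdim
end
end

section
/- Let μ ∈ {1, −1}, {i, j, k} = {1, 2, 3}, and let 𝔥 = k·a_i ⊕ k·(a_j + μ a_k) be the corresponding 2-dimensional subalgebra of g = sl₂^c(k). For φ ∈ 𝔥*, set λ = φ(a_i) and β = φ(a_j + μ a_k). Then φ determines a 1-dimensional 𝔥-module (via a·y = φ(a)y) if and only if β(2λ − μ) = 0; that is, the 1-dimensional 𝔥-modules form exactly the two one-parameter families {φ : φ(a_j + μ a_k) = 0} and {φ : φ(a_i) = μ/2}. Equivalently, the cyclic left U(g)-module U(g)/(U(g)(a_i − λ) + U(g)(a_j + μ a_k − β)) is nonzero if and only if β(2λ − μ) = 0. -/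
/-- Relations of `U(sl₂ᶜ(k)) = k⟨a₁,a₂,a₃⟩/⟨a₁a₂+a₂a₁−a₃, a₂a₃+a₃a₂−a₁, a₃a₁+a₁a₃−a₂⟩`
(generators `0 = a₁, 1 = a₂, 2 = a₃`). -/
inductive UcolRel (k : Type) [Field k] :
    FreeAlgebra k (Fin 3) → FreeAlgebra k (Fin 3) → Prop
  | r12 : UcolRel k
      (FreeAlgebra.ι k 0 * FreeAlgebra.ι k 1 + FreeAlgebra.ι k 1 * FreeAlgebra.ι k 0)
      (FreeAlgebra.ι k 2)
  | r23 : UcolRel k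
      (FreeAlgebra.ι k 1 * FreeAlgebra.ι k 2 + FreeAlgebra.ι k 2 * FreeAlgebra.ι k 1)
      (FreeAlgebra.ι k 0)
  | r31 : UcolRel k
      (FreeAlgebra.ι k 2 * FreeAlgebra.ι k 0 + FreeAlgebra.ι k 0 * FreeAlgebra.ι k 2)
      (FreeAlgebra.ι k 1)

/-- `U(g)` for the color Lie algebra `g = sl₂ᶜ(k)`. -/
abbrev Ucol (k : Type) [Field k] := RingQuot (UcolRel k)

/-- The images of the generators `a₁, a₂, a₃` in `U(g)`. -/
def genC (k : Type) [Field k] (i : Fin 3) : Ucol k :=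
  RingQuot.mkAlgHom k (UcolRel k) (FreeAlgebra.ι k i)

theorem genC_rel (k : Type) [Field k] (i j l : Fin 3) (hij : i ≠ j) (hjl : j ≠ l) (hil : i ≠ l) :
    genC k i * genC k j + genC k j * genC k i = genC k l := by
  have h12 := RingQuot.mkAlgHom_rel k (UcolRel.r12 (k := k))
  have h23 := RingQuot.mkAlgHom_rel k (UcolRel.r23 (k := k))
  have h31 := RingQuot.mkAlgHom_rel k (UcolRel.r31 (k := k))
  simp only [map_add, map_mul] at h12 h23 h31
  change genC k 0 * genC k 1 + genC k 1 * genC k 0 = genC k 2 at h12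
  change genC k 1 * genC k 2 + genC k 2 * genC k 1 = genC k 0 at h23
  change genC k 2 * genC k 0 + genC k 0 * genC k 2 = genC k 1 at h31
  fin_cases i <;> fin_cases j <;> fin_cases l <;>
    first | (exfalso; simp_all; done) | assumption | (rw [add_comm]; assumption)

theorem exists_lift (k : Type) [Field k] {R : Type} [Ring R] [Algebra k R]
    (i j l : Fin 3) (hij : i ≠ j) (hjl : j ≠ l) (hil : i ≠ l) (x y z : R)
    (h1 : x * y + y * x = z) (h2 : y * z + z * y = x) (h3 : z * x + x * z = y) :
    ∃ F : Ucol k →ₐ[k] R, F (genC k i) = x ∧ F (genC k j) = y ∧ F (genC k l) = z := by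
  have key : ∀ X : Fin 3 → R, X 0 * X 1 + X 1 * X 0 = X 2 → X 1 * X 2 + X 2 * X 1 = X 0 →
      X 2 * X 0 + X 0 * X 2 = X 1 → ∃ F : Ucol k →ₐ[k] R, ∀ t, F (genC k t) = X t := by
    intro X h12 h23 h31
    refine ⟨RingQuot.liftAlgHom k ⟨FreeAlgebra.lift k X, ?_⟩, ?_⟩
    · intro a b h
      cases h <;> simp [*]
    · intro t
      simp [genC]
  have h1' : y * x + x * y = z := by rw [add_comm, h1]
  have h2' : z * y + y * z = x := by rw [add_comm, h2]
  have h3' : x * z + z * x = y := by rw [add_comm, h3]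
  obtain ⟨F, hF⟩ := key (fun t => if t = i then x else if t = j then y else z)
    (by fin_cases i <;> fin_cases j <;> fin_cases l <;> simp_all)
    (by fin_cases i <;> fin_cases j <;> fin_cases l <;> simp_all)
    (by fin_cases i <;> fin_cases j <;> fin_cases l <;> simp_all)
  refine ⟨F, ?_, ?_, ?_⟩
  · simp [hF]
  · simp [hF, hij.symm]
  · simp [hF, hil.symm, hjl.symm]

/-- The diagonal operator `a_i` on the completed Verma-type module. -/
def opA (k : Type) [Field k] (μ lam : k) : Module.End k ((ℕ → k) × (ℕ → k)) where
  toFun f := (fun m => (lam + 2 * μ * m) * f.1 m, fun m => (-μ - lam - 2 * μ * m) * f.2 m)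
  map_add' f g := by ext m <;> simp <;> ring
  map_smul' r f := by ext m <;> simp <;> ring

/-- The scalars by which the square of `a_j + μ a_l` acts. -/
def sP (k : Type) [Field k] (μ lam β : k) (m : ℕ) : k :=
  β ^ 2 - 4 * μ * lam * m - 4 * m ^ 2 + 2 * m

/-- The operator `a_j + μ a_l`. -/
def opB (k : Type) [Field k] (μ lam β : k) : Module.End k ((ℕ → k) × (ℕ → k)) where
  toFun f := (fun m => Nat.casesOn m (β * f.1 0) (fun n => f.2 n),
    fun m => sP k μ lam β (m + 1) * f.1 (m + 1))
  map_add' f g := by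
    ext m
    · cases m <;> simp <;> ring
    · simp; ring
  map_smul' r f := by
    ext m
    · cases m <;> simp <;> ring
    · simp; ring

/-- The operator `a_j - μ a_l`. -/
def opC (k : Type) [Field k] (μ lam β : k) : Module.End k ((ℕ → k) × (ℕ → k)) where
  toFun f := (fun m => (sP k μ lam β m - 2 * μ * (lam + 2 * μ * m)) * f.2 m, fun m => f.1 m)
  map_add' f g := by ext m <;> simp <;> ring
  map_smul' r f := by ext m <;> simp <;> ring

theorem opAB (k : Type) [Field k] (μ lam β : k) (h : β * (2 * lam - μ) = 0) :
    opA k μ lam * opB k μ lam β + opB k μ lam β * opA k μ lam = μ • opB k μ lam β := by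
  refine LinearMap.ext fun f => Prod.ext (funext fun m => ?_) (funext fun m => ?_)
  · cases m
    · simp [opA, opB]; linear_combination f.1 0 * h
    · simp [opA, opB]; ring
  · simp [opA, opB]; ring

theorem opAC (k : Type) [Field k] (μ lam β : k) :
    opA k μ lam * opC k μ lam β + opC k μ lam β * opA k μ lam = (-μ) • opC k μ lam β := by
  refine LinearMap.ext fun f => Prod.ext (funext fun m => ?_) (funext fun m => ?_)
  · simp [opA, opC]; ring
  · simp [opA, opC]; ring

theorem opBC (k : Type) [Field k] (μ lam β : k) (h : μ ^ 2 = 1) :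
    opB k μ lam β * opB k μ lam β - opC k μ lam β * opC k μ lam β = (2 * μ) • opA k μ lam := by
  refine LinearMap.ext fun f => Prod.ext (funext fun m => ?_) (funext fun m => ?_)
  · cases m
    · simp [opA, opB, opC, sP]; try ring
    · simp [opA, opB, opC, sP]; try ring
  · simp [opA, opB, opC, sP]
    linear_combination (2 + 8 * (m : k)) * f.2 m * h

theorem exists_rep (k : Type) [Field k] [CharZero k]
    (i j l : Fin 3) (hij : i ≠ j) (hjl : j ≠ l) (hil : i ≠ l)
    (μ : k) (hμ : μ ^ 2 = 1) (lam β : k) (h : β * (2 * lam - μ) = 0) :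
    ∃ F : Ucol k →ₐ[k] Module.End k ((ℕ → k) × (ℕ → k)),
      F (genC k i) = opA k μ lam ∧ F (genC k j) + μ • F (genC k l) = opB k μ lam β := by
  have hAB := opAB k μ lam β h
  have hAC := opAC k μ lam β
  have hBC := opBC k μ lam β hμ
  set A := opA k μ lam
  set B := opB k μ lam β
  set C := opC k μ lam β
  have h2 : (2 : k) ≠ 0 := two_ne_zero
  have hmain := exists_lift k i j l hij hjl hil A
    ((1 / 2 : k) • (B + C)) ((μ / 2) • (B - C))
  refine Exists.elim (hmain ?_ ?_ ?_) ?_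
  rotate_left 3
  · rintro F ⟨hi, hj, hl⟩
    refine ⟨F, hi, ?_⟩
    rw [hj, hl]
    match_scalars
    · field_simp; linear_combination hμ
    · field_simp; linear_combination -hμ
  · have : A * ((1 / 2 : k) • (B + C)) + ((1 / 2 : k) • (B + C)) * A
        = (1 / 2 : k) • ((A * B + B * A) + (A * C + C * A)) := by
      simp only [mul_smul_comm, smul_mul_assoc, mul_add, add_mul]; module
    rw [this, hAB, hAC]
    module
  · have : ((1 / 2 : k) • (B + C)) * ((μ / 2) • (B - C)) + ((μ / 2) • (B - C)) * ((1 / 2 : k) • (B + C))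
        = (μ / 2) • (B * B - C * C) := by
      simp only [mul_smul_comm, smul_mul_assoc, mul_add, add_mul, mul_sub, sub_mul]; module
    rw [this, hBC]
    match_scalars
    field_simp; linear_combination hμ
  · have : ((μ / 2) • (B - C)) * A + A * ((μ / 2) • (B - C))
        = (μ / 2) • ((A * B + B * A) - (A * C + C * A)) := by
      simp only [mul_smul_comm, smul_mul_assoc, mul_sub, sub_mul]; module
    rw [this, hAB, hAC]
    match_scalars
    · field_simp; linear_combination hμ
    · field_simp; linear_combination hμ

theorem stmt12 (k : Type) [Field k] [IsAlgClosed k] [CharZero k]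
    (i j l : Fin 3) (hij : i ≠ j) (hjl : j ≠ l) (hil : i ≠ l)
    (μ : k) (hμ : μ = 1 ∨ μ = -1) (lam β : k) :
    -- `φ` (with `φ(a_i) = lam`, `φ(a_j + μa_l) = β`) determines a 1-dimensional 𝔥-module,
    -- i.e. the cyclic left U(g)-module U(g)/(U(g)(a_i − lam) + U(g)(a_j + μa_l − β))
    -- is nonzero, iff β(2·lam − μ) = 0 …
    ((Submodule.span (Ucol k)
        {genC k i - algebraMap k (Ucol k) lam,
         genC k j + μ • genC k l - algebraMap k (Ucol k) β} ≠ ⊤) ↔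
      β * (2 * lam - μ) = 0) ∧
    -- … that is, exactly the two one-parameter families φ(a_j + μa_l) = 0 and φ(a_i) = μ/2
    (β * (2 * lam - μ) = 0 ↔ (β = 0 ∨ lam = μ / 2)) := by
  have hμ2 : μ ^ 2 = 1 := by rcases hμ with rfl | rfl <;> norm_num
  refine ⟨⟨fun hne => ?_, fun h htop => ?_⟩, ?_⟩
  · by_contra hb
    apply hne
    rw [Ideal.eq_top_iff_one]
    set I := Submodule.span (Ucol k)
        {genC k i - algebraMap k (Ucol k) lam,
         genC k j + μ • genC k l - algebraMap k (Ucol k) β} with hI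
    have hu : genC k i - algebraMap k (Ucol k) lam ∈ I := Submodule.subset_span (by simp)
    have hw : genC k j + μ • genC k l - algebraMap k (Ucol k) β ∈ I :=
      Submodule.subset_span (by simp)
    have h1 := genC_rel k i j l hij hjl hil
    have h2 := genC_rel k i l j hil hjl.symm hij
    generalize genC k i = a at *
    generalize genC k j = y at *
    generalize genC k l = z at *
    have hab : a * (y + μ • z) + (y + μ • z) * a = μ • (y + μ • z) := by
      have : a * (y + μ • z) + (y + μ • z) * a = (a * y + y * a) + μ • (a * z + z * a) := by
        simp only [mul_smul_comm, smul_mul_assoc, mul_add, add_mul]; module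
      rw [this, h1, h2]
      match_scalars
      · linear_combination -hμ2
      · ring
    generalize y + μ • z = b at *
    have hmem := I.add_mem (I.smul_mem (a - algebraMap k (Ucol k) (μ - lam)) hw)
      (I.smul_mem (b + algebraMap k (Ucol k) β) hu)
    have heq : (a - algebraMap k (Ucol k) (μ - lam)) • (b - algebraMap k (Ucol k) β) +
        (b + algebraMap k (Ucol k) β) • (a - algebraMap k (Ucol k) lam) =
        algebraMap k (Ucol k) (-(β * (2 * lam - μ))) := by
      have : (a - algebraMap k (Ucol k) (μ - lam)) • (b - algebraMap k (Ucol k) β) +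
        (b + algebraMap k (Ucol k) β) • (a - algebraMap k (Ucol k) lam) =
        (a * b + b * a - μ • b) + algebraMap k (Ucol k) (-(β * (2 * lam - μ))) := by
        simp only [Algebra.algebraMap_eq_smul_one, smul_eq_mul, mul_smul_comm, smul_mul_assoc,
          mul_add, add_mul, mul_sub, sub_mul, mul_one, one_mul]
        module
      rw [this, hab, sub_self, zero_add]
    rw [heq] at hmem
    have h3 := I.smul_mem (algebraMap k (Ucol k) (-(β * (2 * lam - μ)))⁻¹) hmem
    rwa [smul_eq_mul, ← map_mul, inv_mul_cancel₀ (neg_ne_zero.mpr hb), map_one] at h3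
  · obtain ⟨F, hA, hB⟩ := exists_rep k i j l hij hjl hil μ hμ2 lam β h
    have h1 : (1 : Ucol k) ∈ Submodule.span (Ucol k)
        {genC k i - algebraMap k (Ucol k) lam,
         genC k j + μ • genC k l - algebraMap k (Ucol k) β} := by rw [htop]; trivial
    obtain ⟨p, q, hpq⟩ := Submodule.mem_span_pair.mp h1
    let v : (ℕ → k) × (ℕ → k) := (Pi.single 0 1, 0)
    have hv1 : opA k μ lam v = lam • v := by
      refine Prod.ext (funext fun m => ?_) (funext fun m => ?_)
      · cases m <;> simp [opA, v]
      · simp [opA, v]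
    have hv2 : opB k μ lam β v = β • v := by
      refine Prod.ext (funext fun m => ?_) (funext fun m => ?_)
      · cases m <;> simp [opB, v]
      · simp [opB, v]
    have h2 := congrArg (fun t => F t v) hpq
    simp only [smul_eq_mul, map_add, map_mul, map_sub, map_smul, map_one, AlgHom.commutes,
      LinearMap.add_apply, Module.End.mul_apply, LinearMap.sub_apply, hA, hB,
      Module.algebraMap_end_apply, Module.End.one_apply] at h2
    rw [hv1, hv2, map_smul, map_smul, sub_self, sub_self, add_zero] at h2
    have h3 := congrFun (congrArg Prod.fst h2) 0
    simp [v] at h3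
  · rw [mul_eq_zero, sub_eq_zero, eq_div_iff (two_ne_zero), mul_comm lam]
end

section
/- The set of monomials {a₁^i a₂^j a₃^k : i, j, k ≥ 0} is a k-vector-space basis of U(g) = k⟨a₁,a₂,a₃⟩/⟨a₁a₂ + a₂a₁ − a₃, a₂a₃ + a₃a₂ − a₁, a₃a₁ + a₁a₃ − a₂⟩; in particular, the generators a₁, a₂, a₃ span a 3-dimensional subspace of U(g). -/
open Polynomial in
/-- The reflection `x ↦ s - x` on `k[c][x]`. -/
noncomputable def reflC (k : Type) [Field k] (s : k) : (k[X])[X] →ₐ[k] (k[X])[X] :=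
  (Polynomial.aeval (R := k[X]) (C (C s) - X : (k[X])[X])).restrictScalars k

section rep
open Polynomial
variable (k : Type) [Field k]

lemma reflC_X (s : k) : reflC k s X = C (C s) - X := by simp [reflC]

lemma reflC_C (s : k) (a : k[X]) : reflC k s (C a) = C a := by
  simp [reflC]

lemma reflC_reflC (s : k) (f : (k[X])[X]) : reflC k s (reflC k s f) = f := by
  induction f using Polynomial.induction_on' with
  | add p q hp hq => simp [hp, hq]
  | monomial n a =>
    rw [← C_mul_X_pow_eq_monomial]
    simp [reflC_X, reflC_C]

/-- The polynomial by which `u²` acts. -/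
noncomputable def PC : (k[X])[X] := C X - (X ^ 2 - X)
/-- The polynomial by which `v²` acts. -/
noncomputable def QC : (k[X])[X] := C X - (X ^ 2 + X)

lemma refl_PC : reflC k 1 (PC k) = PC k := by
  simp [PC, reflC_X, reflC_C]; ring

lemma refl_QC : reflC k (-1) (QC k) = QC k := by
  simp [QC, reflC_X, reflC_C]; ring

lemma PC_ne : PC k ≠ 0 := by
  intro h
  have := congrArg (fun f => Polynomial.coeff f 2) h
  simp [PC, coeff_X] at this

lemma QC_ne : QC k ≠ 0 := by
  intro h
  have := congrArg (fun f => Polynomial.coeff f 2) h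
  simp [QC, coeff_X] at this

/-- The representation space. -/
abbrev VC := ℤ → (k[X])[X]

/-- multiplication by `x` -/
noncomputable def opX : Module.End k (VC k) where
  toFun f n := X * f n
  map_add' f g := by ext1 n; simp [mul_add]
  map_smul' a f := by ext1 n; simp

/-- action of `u` -/
noncomputable def opU : Module.End k (VC k) where
  toFun f n := if Even n then PC k * reflC k 1 (f (n + 1)) else reflC k 1 (f (n - 1))
  map_add' f g := by ext1 n; by_cases h : Even n <;> simp [h, mul_add]
  map_smul' a f := by ext1 n; by_cases h : Even n <;> simp [h]

/-- action of `v` -/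
noncomputable def opV : Module.End k (VC k) where
  toFun f n := if Even n then QC k * reflC k (-1) (f (n - 1)) else reflC k (-1) (f (n + 1))
  map_add' f g := by ext1 n; by_cases h : Even n <;> simp [h, mul_add]
  map_smul' a f := by ext1 n; by_cases h : Even n <;> simp [h]

lemma opX_apply (f : VC k) (n : ℤ) : opX k f n = X * f n := rfl
lemma opU_apply (f : VC k) (n : ℤ) : opU k f n =
    if Even n then PC k * reflC k 1 (f (n + 1)) else reflC k 1 (f (n - 1)) := rfl
lemma opV_apply (f : VC k) (n : ℤ) : opV k f n =
    if Even n then QC k * reflC k (-1) (f (n - 1)) else reflC k (-1) (f (n + 1)) := rfl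

lemma opUU (f : VC k) (n : ℤ) : opU k (opU k f) n = PC k * f n := by
  by_cases h : Even n
  · have h' : ¬ Even (n + 1) := by grind
    simp [opU_apply, h, h', reflC_reflC]
  · have h' : Even (n - 1) := by grind
    simp [opU_apply, h, h', reflC_reflC, refl_PC]

lemma opVV (f : VC k) (n : ℤ) : opV k (opV k f) n = QC k * f n := by
  by_cases h : Even n
  · have h' : ¬ Even (n - 1) := by grind
    simp [opV_apply, h, h', reflC_reflC]
  · have h' : Even (n + 1) := by grind
    simp [opV_apply, h, h', reflC_reflC, refl_QC]

lemma opUX : opX k * opU k + opU k * opX k = opU k := by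
  ext1 f; ext1 n
  by_cases h : Even n <;> simp [opU_apply, opX_apply, h, reflC_X] <;> ring

lemma opVX : opX k * opV k + opV k * opX k = - opV k := by
  ext1 f; ext1 n
  by_cases h : Even n <;> simp [opV_apply, opX_apply, h, reflC_X] <;> ring

lemma opUV : opU k * opU k - opV k * opV k = (2 : k) • opX k := by
  ext1 f; ext1 n
  simp [opUU, opVV, opX_apply, PC, QC, two_smul]; ring

/-- images of the generators -/
noncomputable def opG : Fin 3 → Module.End k (VC k) :=
  ![opX k, (2⁻¹ : k) • (opU k + opV k), (2⁻¹ : k) • (opU k - opV k)]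

lemma abs_rel12 {A : Type*} [Ring A] [Algebra k A] (x u v : A) (h1 : x * u + u * x = u)
    (h2 : x * v + v * x = -v) (t : k) :
    x * (t • (u + v)) + (t • (u + v)) * x = t • (u - v) := by
  rw [mul_smul_comm, smul_mul_assoc, ← smul_add]
  congr 1
  calc _ = (x * u + u * x) + (x * v + v * x) := by noncomm_ring
    _ = _ := by rw [h1, h2]; abel

lemma abs_rel31 {A : Type*} [Ring A] [Algebra k A] (x u v : A) (h1 : x * u + u * x = u)
    (h2 : x * v + v * x = -v) (t : k) :
    (t • (u - v)) * x + x * (t • (u - v)) = t • (u + v) := by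
  rw [mul_smul_comm, smul_mul_assoc, ← smul_add]
  congr 1
  calc _ = (x * u + u * x) - (x * v + v * x) := by noncomm_ring
    _ = _ := by rw [h1, h2]; abel

lemma abs_rel23 {A : Type*} [Ring A] [Algebra k A] (x u v : A)
    (h3 : u * u - v * v = (2 : k) • x) (h2 : (2 : k) ≠ 0) :
    ((2⁻¹ : k) • (u + v)) * ((2⁻¹ : k) • (u - v)) +
      ((2⁻¹ : k) • (u - v)) * ((2⁻¹ : k) • (u + v)) = x := by
  simp only [mul_smul_comm, smul_mul_assoc, ← smul_add]
  have : (u + v) * (u - v) + (u - v) * (u + v) = (2 : k) • (u * u - v * v) := by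
    rw [two_smul]; noncomm_ring
  rw [this, h3, smul_smul, smul_smul, smul_smul]
  have e : (2⁻¹ : k) * (2⁻¹ * (2 * 2)) = 1 := by field_simp
  have e' : (2⁻¹ : k) * 2⁻¹ * 2 * 2 = 1 := by field_simp
  first
    | rw [e, one_smul]
    | rw [e', one_smul]
    | (simp only [mul_assoc] at *; rw [e, one_smul])

lemma abs_half {A : Type*} [Ring A] [Algebra k A] (u v : A) (h2 : (2 : k) ≠ 0) :
    (2⁻¹ : k) • (u + v) + (2⁻¹ : k) • (u - v) = u := by
  rw [← smul_add, show u + v + (u - v) = (2 : k) • u by rw [two_smul]; abel,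
    smul_smul, inv_mul_cancel₀ h2, one_smul]

lemma abs_half' {A : Type*} [Ring A] [Algebra k A] (u v : A) (h2 : (2 : k) ≠ 0) :
    (2⁻¹ : k) • (u + v) - (2⁻¹ : k) • (u - v) = v := by
  rw [← smul_sub, show u + v - (u - v) = (2 : k) • v by rw [two_smul]; abel,
    smul_smul, inv_mul_cancel₀ h2, one_smul]

lemma opG_rel [CharZero k] : ∀ ⦃a b : FreeAlgebra k (Fin 3)⦄, UcolRel k a b →
    FreeAlgebra.lift k (opG k) a = FreeAlgebra.lift k (opG k) b := by
  intro a b h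
  cases h with
  | r12 =>
    rw [map_add, map_mul, map_mul, FreeAlgebra.lift_ι_apply, FreeAlgebra.lift_ι_apply,
      FreeAlgebra.lift_ι_apply]
    exact abs_rel12 (A := Module.End k (VC k)) k (opX k) (opU k) (opV k) (opUX k) (opVX k) _
  | r23 =>
    rw [map_add, map_mul, map_mul, FreeAlgebra.lift_ι_apply, FreeAlgebra.lift_ι_apply,
      FreeAlgebra.lift_ι_apply]
    exact abs_rel23 (A := Module.End k (VC k)) k (opX k) (opU k) (opV k) (opUV k) two_ne_zero
  | r31 =>
    rw [map_add, map_mul, map_mul, FreeAlgebra.lift_ι_apply, FreeAlgebra.lift_ι_apply,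
      FreeAlgebra.lift_ι_apply]
    exact abs_rel31 (A := Module.End k (VC k)) k (opX k) (opU k) (opV k) (opUX k) (opVX k) _

/-- The representation of `U(g)`. -/
noncomputable def rhoC [CharZero k] : Ucol k →ₐ[k] Module.End k (VC k) :=
  RingQuot.liftAlgHom k ⟨FreeAlgebra.lift k (opG k), opG_rel k⟩

lemma rhoC_gen [CharZero k] (i : Fin 3) : rhoC k (genC k i) = opG k i := by
  simp [rhoC, genC]

lemma rhoC_x [CharZero k] : rhoC k (genC k 0) = opX k := by
  rw [rhoC_gen]; rfl

lemma rhoC_u [CharZero k] : rhoC k (genC k 1 + genC k 2) = opU k := by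
  rw [map_add, rhoC_gen, rhoC_gen]
  exact abs_half (A := Module.End k (VC k)) k (opU k) (opV k) two_ne_zero

lemma rhoC_v [CharZero k] : rhoC k (genC k 1 - genC k 2) = opV k := by
  rw [map_sub, rhoC_gen, rhoC_gen]
  exact abs_half' (A := Module.End k (VC k)) k (opU k) (opV k) two_ne_zero

/-- The Casimir element. -/
noncomputable def casC : Ucol k :=
  (genC k 1 + genC k 2) * (genC k 1 + genC k 2) + genC k 0 * genC k 0 - genC k 0

lemma rhoC_cas [CharZero k] (f : VC k) (n : ℤ) : rhoC k (casC k) f n = C X * f n := by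
  rw [casC, map_sub, map_add, map_mul, map_mul, rhoC_u, rhoC_x]
  simp [opUU, opX_apply, PC]; ring

lemma opU_single_even (n : ℤ) (h : Even n) (g : (k[X])[X]) :
    opU k (Pi.single n g) = Pi.single (n + 1) (reflC k 1 g) := by
  ext1 m
  by_cases hm : Even m
  · have h1 : m + 1 ≠ n := by grind
    have h2 : m ≠ n + 1 := by grind
    simp [opU_apply, hm, h1, h2]
  · by_cases h1 : m = n + 1
    · subst h1; simp [opU_apply, hm]
    · have h2 : m - 1 ≠ n := by grind
      simp [opU_apply, hm, h1, h2]

lemma opU_single_odd (n : ℤ) (h : ¬ Even n) (g : (k[X])[X]) :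
    opU k (Pi.single n g) = Pi.single (n - 1) (PC k * reflC k 1 g) := by
  ext1 m
  by_cases hm : Even m
  · by_cases h1 : m = n - 1
    · subst h1; simp [opU_apply, hm]
    · have h2 : m + 1 ≠ n := by grind
      simp [opU_apply, hm, h1, h2]
  · have h1 : m - 1 ≠ n := by grind
    have h2 : m ≠ n - 1 := by grind
    simp [opU_apply, hm, h1, h2]

lemma opV_single_even (n : ℤ) (h : Even n) (g : (k[X])[X]) :
    opV k (Pi.single n g) = Pi.single (n - 1) (reflC k (-1) g) := by
  ext1 m
  by_cases hm : Even m
  · have h1 : m - 1 ≠ n := by grind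
    have h2 : m ≠ n - 1 := by grind
    simp [opV_apply, hm, h1, h2]
  · by_cases h1 : m = n - 1
    · subst h1; simp [opV_apply, hm]
    · have h2 : m + 1 ≠ n := by grind
      simp [opV_apply, hm, h1, h2]

lemma opV_single_odd (n : ℤ) (h : ¬ Even n) (g : (k[X])[X]) :
    opV k (Pi.single n g) = Pi.single (n + 1) (QC k * reflC k (-1) g) := by
  ext1 m
  by_cases hm : Even m
  · by_cases h1 : m = n + 1
    · subst h1; simp [opV_apply, hm]
    · have h2 : m - 1 ≠ n := by grind
      simp [opV_apply, hm, h1, h2]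
  · have h1 : m + 1 ≠ n := by grind
    have h2 : m ≠ n + 1 := by grind
    simp [opV_apply, hm, h1, h2]

lemma reflC_ne (s : k) {g : (k[X])[X]} (h : g ≠ 0) : reflC k s g ≠ 0 := by
  intro h0
  apply h
  rw [← reflC_reflC k s g, h0, map_zero]

end rep

section filt
variable (k : Type) [Field k]

/-- ordered monomials -/
noncomputable def monC (p : ℕ × ℕ × ℕ) : Ucol k :=
  genC k 0 ^ p.1 * genC k 1 ^ p.2.1 * genC k 2 ^ p.2.2

/-- degree of an exponent vector -/
def degC (p : ℕ × ℕ × ℕ) : ℕ := p.1 + p.2.1 + p.2.2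

/-- span of ordered monomials of degree at most `n` -/
noncomputable def filC (n : ℕ) : Submodule k (Ucol k) :=
  Submodule.span k (Set.image (monC k) {p | degC p ≤ n})

lemma filC_mono {m n : ℕ} (h : m ≤ n) : filC k m ≤ filC k n :=
  Submodule.span_mono (Set.image_mono fun _ hp => le_trans hp h)

lemma mon_mem {n : ℕ} (p : ℕ × ℕ × ℕ) (h : degC p ≤ n) : monC k p ∈ filC k n :=
  Submodule.subset_span ⟨p, h, rfl⟩

/-- left multiplication by `a` raises the degree by at most `d` -/
def HasDeg (a : Ucol k) (d : ℕ) : Prop := ∀ n, ∀ b ∈ filC k n, a * b ∈ filC k (n + d)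

lemma mul_fil {a : Ucol k} {n m : ℕ} (h : ∀ p, degC p ≤ n → a * monC k p ∈ filC k m) :
    ∀ b ∈ filC k n, a * b ∈ filC k m := by
  intro b hb
  have : filC k n ≤ (filC k m).comap (LinearMap.mulLeft k a) := by
    apply Submodule.span_le.2
    rintro _ ⟨p, hp, rfl⟩
    exact h p hp
  exact this hb

lemma rel12 : genC k 0 * genC k 1 + genC k 1 * genC k 0 = genC k 2 := by
  have := RingQuot.mkAlgHom_rel k (UcolRel.r12 (k := k))
  simpa [genC] using this
lemma rel23 : genC k 1 * genC k 2 + genC k 2 * genC k 1 = genC k 0 := by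
  have := RingQuot.mkAlgHom_rel k (UcolRel.r23 (k := k))
  simpa [genC] using this
lemma rel31 : genC k 2 * genC k 0 + genC k 0 * genC k 2 = genC k 1 := by
  have := RingQuot.mkAlgHom_rel k (UcolRel.r31 (k := k))
  simpa [genC] using this

lemma mon_succ_x (i j l : ℕ) : monC k (i + 1, j, l) = genC k 0 * monC k (i, j, l) := by
  simp [monC, pow_succ', mul_assoc]
lemma mon_succ_y (j l : ℕ) : monC k (0, j + 1, l) = genC k 1 * monC k (0, j, l) := by
  simp [monC, pow_succ', mul_assoc]
lemma mon_succ_z (l : ℕ) : monC k (0, 0, l + 1) = genC k 2 * monC k (0, 0, l) := by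
  simp [monC, pow_succ']

lemma hasDeg_x : HasDeg k (genC k 0) 1 := by
  intro n
  apply mul_fil
  rintro ⟨i, j, l⟩ h
  rw [← mon_succ_x]
  apply mon_mem
  simp only [degC] at *; omega

lemma deg_yz (n : ℕ) : (∀ b ∈ filC k n, genC k 1 * b ∈ filC k (n + 1)) ∧
    (∀ b ∈ filC k n, genC k 2 * b ∈ filC k (n + 1)) := by
  induction n using Nat.strong_induction_on with
  | _ n ih =>
    have hy : ∀ b ∈ filC k n, genC k 1 * b ∈ filC k (n + 1) := by
      apply mul_fil
      rintro ⟨i, j, l⟩ h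
      simp only [degC] at h
      cases i with
      | zero =>
        rw [← mon_succ_y]
        apply mon_mem
        simp only [degC]; omega
      | succ i =>
        obtain ⟨m, rfl⟩ : ∃ m, n = m + 1 := ⟨n - 1, by omega⟩
        obtain ⟨h1, h2⟩ := ih m (by omega)
        have hm : monC k (i, j, l) ∈ filC k m := mon_mem k _ (by simp only [degC]; omega)
        rw [mon_succ_x, ← mul_assoc, eq_sub_of_add_eq' (rel12 k), sub_mul, mul_assoc]
        exact sub_mem (filC_mono k (by omega) (h2 _ hm)) (hasDeg_x k _ _ (h1 _ hm))
    refine ⟨hy, ?_⟩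
    apply mul_fil
    rintro ⟨i, j, l⟩ h
    simp only [degC] at h
    cases i with
    | succ i =>
      obtain ⟨m, rfl⟩ : ∃ m, n = m + 1 := ⟨n - 1, by omega⟩
      obtain ⟨h1, h2⟩ := ih m (by omega)
      have hm : monC k (i, j, l) ∈ filC k m := mon_mem k _ (by simp only [degC]; omega)
      rw [mon_succ_x, ← mul_assoc, eq_sub_of_add_eq (rel31 k), sub_mul, mul_assoc]
      exact sub_mem (filC_mono k (by omega) (h1 _ hm)) (hasDeg_x k _ _ (h2 _ hm))
    | zero =>
      cases j with
      | zero =>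
        rw [← mon_succ_z]
        apply mon_mem
        simp only [degC]; omega
      | succ j =>
        obtain ⟨m, rfl⟩ : ∃ m, n = m + 1 := ⟨n - 1, by omega⟩
        obtain ⟨h1, h2⟩ := ih m (by omega)
        have hm : monC k (0, j, l) ∈ filC k m := mon_mem k _ (by simp only [degC]; omega)
        rw [mon_succ_y, ← mul_assoc, eq_sub_of_add_eq' (rel23 k), sub_mul, mul_assoc]
        exact sub_mem (filC_mono k (by omega) (hasDeg_x k _ _ hm)) (hy _ (h2 _ hm))

lemma hasDeg_y : HasDeg k (genC k 1) 1 := fun n => (deg_yz k n).1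
lemma hasDeg_z : HasDeg k (genC k 2) 1 := fun n => (deg_yz k n).2

variable {k}
lemma HasDeg.add {a b : Ucol k} {d : ℕ} (ha : HasDeg k a d) (hb : HasDeg k b d) :
    HasDeg k (a + b) d := fun n c hc => by
  rw [add_mul]; exact add_mem (ha n c hc) (hb n c hc)
lemma HasDeg.sub {a b : Ucol k} {d : ℕ} (ha : HasDeg k a d) (hb : HasDeg k b d) :
    HasDeg k (a - b) d := fun n c hc => by
  rw [sub_mul]; exact sub_mem (ha n c hc) (hb n c hc)
lemma HasDeg.mul {a b : Ucol k} {d e : ℕ} (ha : HasDeg k a d) (hb : HasDeg k b e) :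
    HasDeg k (a * b) (e + d) := fun n c hc => by
  rw [mul_assoc, ← add_assoc]; exact ha _ _ (hb n c hc)
lemma HasDeg.mono {a : Ucol k} {d e : ℕ} (ha : HasDeg k a d) (h : d ≤ e) :
    HasDeg k a e := fun n c hc => filC_mono k (by omega) (ha n c hc)
lemma HasDeg.one : HasDeg k 1 0 := fun n c hc => by simpa using hc
lemma HasDeg.pow {a : Ucol k} {d : ℕ} (ha : HasDeg k a d) (i : ℕ) : HasDeg k (a ^ i) (i * d) := by
  induction i with
  | zero => simpa using HasDeg.one
  | succ i ih => rw [pow_succ]; exact (ih.mul ha).mono (by rw [Nat.succ_mul]; omega)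
variable (k)

lemma one_mem_fil (n : ℕ) : (1 : Ucol k) ∈ filC k n := by
  have := mon_mem k (n := n) (0, 0, 0) (by simp [degC])
  simpa [monC] using this

lemma HasDeg.mem {k : Type} [Field k] {a : Ucol k} {d : ℕ} (ha : HasDeg k a d) :
    a ∈ filC k d := by
  simpa using ha 0 1 (one_mem_fil k 0)

lemma hasDeg_cas : HasDeg k (casC k) 2 := by
  have hu := (hasDeg_y k).add (hasDeg_z k)
  exact ((hu.mul hu).add ((hasDeg_x k).mul (hasDeg_x k))).sub ((hasDeg_x k).mono (by omega))

lemma exists_deg (a : Ucol k) : ∃ d, HasDeg k a d := by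
  obtain ⟨b, rfl⟩ := RingQuot.mkAlgHom_surjective k (UcolRel k) a
  induction b using FreeAlgebra.induction with
  | grade0 r =>
    refine ⟨0, fun n c hc => ?_⟩
    rw [AlgHom.commutes, ← Algebra.smul_def]
    exact Submodule.smul_mem _ _ hc
  | grade1 i =>
    refine ⟨1, ?_⟩
    fin_cases i
    · exact hasDeg_x k
    · exact hasDeg_y k
    · exact hasDeg_z k
  | mul a b ha hb =>
    obtain ⟨d, hd⟩ := ha
    obtain ⟨e, he⟩ := hb
    exact ⟨_, by rw [map_mul]; exact hd.mul he⟩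
  | add a b ha hb =>
    obtain ⟨d, hd⟩ := ha
    obtain ⟨e, he⟩ := hb
    exact ⟨d + e, by rw [map_add]; exact (hd.mono (by omega)).add (he.mono (by omega))⟩

lemma span_mon : Submodule.span k (Set.range (monC k)) = ⊤ := by
  rw [eq_top_iff]
  intro a _
  obtain ⟨d, hd⟩ := exists_deg k a
  exact Submodule.span_mono (Set.image_subset_range _ _) hd.mem

end filt

section main
open Polynomial
variable (k : Type) [Field k] [CharZero k]

lemma exists_word_pos (n : ℕ) : ∃ (w : Ucol k) (g : (k[X])[X]), HasDeg k w n ∧ g ≠ 0 ∧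
    rhoC k w (Pi.single 0 1) = Pi.single (n : ℤ) g := by
  induction n with
  | zero => exact ⟨1, 1, HasDeg.one, one_ne_zero, by simp⟩
  | succ n ih =>
    obtain ⟨w, g, hw, hg, h⟩ := ih
    by_cases hn : Even (n : ℤ)
    · refine ⟨(genC k 1 + genC k 2) * w, reflC k 1 g,
        (((hasDeg_y k).add (hasDeg_z k)).mul hw), reflC_ne k _ hg, ?_⟩
      rw [map_mul, rhoC_u, Module.End.mul_apply, h, opU_single_even k _ hn]
      simp
    · refine ⟨(genC k 1 - genC k 2) * w, QC k * reflC k (-1) g,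
        (((hasDeg_y k).sub (hasDeg_z k)).mul hw), mul_ne_zero (QC_ne k) (reflC_ne k _ hg), ?_⟩
      rw [map_mul, rhoC_v, Module.End.mul_apply, h, opV_single_odd k _ hn]
      simp

lemma exists_word_neg (n : ℕ) : ∃ (w : Ucol k) (g : (k[X])[X]), HasDeg k w n ∧ g ≠ 0 ∧
    rhoC k w (Pi.single 0 1) = Pi.single (-n : ℤ) g := by
  induction n with
  | zero => exact ⟨1, 1, HasDeg.one, one_ne_zero, by simp⟩
  | succ n ih =>
    obtain ⟨w, g, hw, hg, h⟩ := ih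
    have e : (-((n + 1 : ℕ) : ℤ)) = -(n : ℤ) - 1 := by push_cast; ring
    rw [e]
    by_cases hn : Even (-n : ℤ)
    · refine ⟨(genC k 1 - genC k 2) * w, reflC k (-1) g,
        (((hasDeg_y k).sub (hasDeg_z k)).mul hw), reflC_ne k _ hg, ?_⟩
      rw [map_mul, rhoC_v, Module.End.mul_apply, h, opV_single_even k _ hn]
    · refine ⟨(genC k 1 + genC k 2) * w, PC k * reflC k 1 g,
        (((hasDeg_y k).add (hasDeg_z k)).mul hw), mul_ne_zero (PC_ne k) (reflC_ne k _ hg), ?_⟩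
      rw [map_mul, rhoC_u, Module.End.mul_apply, h, opU_single_odd k _ hn]

lemma exists_word (n : ℤ) : ∃ (w : Ucol k) (g : (k[X])[X]), HasDeg k w n.natAbs ∧ g ≠ 0 ∧
    rhoC k w (Pi.single 0 1) = Pi.single n g := by
  rcases Int.natAbs_eq n with h | h
  · have := exists_word_pos k n.natAbs
    rwa [← h] at this
  · have := exists_word_neg k n.natAbs
    rwa [← h] at this

lemma rhoC_x_pow (i : ℕ) (f : VC k) (n : ℤ) :
    rhoC k (genC k 0 ^ i) f n = X ^ i * f n := by
  induction i with
  | zero => simp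
  | succ i ih =>
    rw [pow_succ', map_mul, Module.End.mul_apply, rhoC_x, opX_apply, ih, pow_succ', mul_assoc]

lemma rhoC_cas_pow (i : ℕ) (f : VC k) (n : ℤ) :
    rhoC k (casC k ^ i) f n = C X ^ i * f n := by
  induction i with
  | zero => simp
  | succ i ih =>
    rw [pow_succ', map_mul, Module.End.mul_apply, rhoC_cas, ih, pow_succ', mul_assoc]

lemma coeff_XC (a b c d : ℕ) : ((X ^ c * C X ^ d : (k[X])[X]).coeff a).coeff b =
    if a = c ∧ b = d then 1 else 0 := by
  rw [← C_pow, coeff_mul_C, coeff_X_pow]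
  by_cases h : a = c <;> simp [h, coeff_X_pow]

lemma indep_XC : LinearIndependent k
    (fun q : ℕ × ℕ => (X ^ q.1 * C X ^ q.2 : (k[X])[X])) := by
  rw [linearIndependent_iff]
  intro l hl
  ext ⟨a, b⟩
  have := congrArg (fun f : (k[X])[X] => (f.coeff a).coeff b) hl
  rw [Finsupp.linearCombination_apply, Finsupp.sum] at this
  simp only [finsetSum_coeff, coeff_zero, coeff_smul, coeff_XC] at this
  rw [Finset.sum_eq_single (a, b)] at this
  · simpa using this
  · rintro ⟨c, d⟩ _ hne
    have : ¬ (a = c ∧ b = d) := by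
      rintro ⟨rfl, rfl⟩
      exact hne rfl
    simp [this]
  · intro h
    simp [Finsupp.notMem_support_iff.1 h]

lemma exists_indep : ∃ b : ℕ × ℕ × ℕ → Ucol k, LinearIndependent k b ∧
    ∀ p, b p ∈ filC k (degC p) := by
  choose w g hw hg h using exists_word k
  refine ⟨fun p => genC k 0 ^ p.1 * (casC k ^ (min p.2.1 p.2.2) * w ((p.2.1 : ℤ) - p.2.2)), ?_, ?_⟩
  · have key := Pi.linearIndependent_single (R := k) (η := ℤ) (ιs := fun _ => ℕ × ℕ)
      (Ms := fun _ => (k[X])[X]) (fun n q => g n * (X ^ q.1 * C X ^ q.2)) (by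
        intro n
        refine (indep_XC k).map' (LinearMap.mulLeft k (g n)) ?_
        rw [LinearMap.ker_eq_bot]
        exact mul_right_injective₀ (hg n))
    have key2 := key.comp (fun p : ℕ × ℕ × ℕ =>
      (⟨(p.2.1 : ℤ) - p.2.2, (p.1, min p.2.1 p.2.2)⟩ : Σ _ : ℤ, ℕ × ℕ)) (by
        rintro ⟨a, b, c⟩ ⟨a2, b2, c2⟩ h
        simp only [Sigma.mk.injEq, heq_eq_eq, Prod.mk.injEq] at h ⊢
        omega)
    refine LinearIndependent.of_comp
      ((LinearMap.applyₗ (Pi.single 0 1 : VC k)).comp (rhoC k).toLinearMap) ?_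
    convert key2 using 1
    swap
    · rfl
    ext1 p
    ext1 m
    simp only [Function.comp_apply, LinearMap.comp_apply, AlgHom.toLinearMap_apply,
      LinearMap.applyₗ_apply_apply, map_mul, Module.End.mul_apply]
    rw [rhoC_x_pow, rhoC_cas_pow, h]
    by_cases hm : m = (p.2.1 : ℤ) - p.2.2
    · subst hm
      simp
      ring
    · simp [hm]
  · intro p
    have h1 := ((hasDeg_x k).pow p.1).mul
      (((hasDeg_cas k).pow (min p.2.1 p.2.2)).mul (hw ((p.2.1 : ℤ) - p.2.2)))
    refine (h1.mono ?_).mem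
    simp only [degC]
    omega

lemma indep_mon : LinearIndependent k (monC k) := by
  obtain ⟨b, hb, hd⟩ := exists_indep k
  have fin : ∀ n, Finite {p | degC p ≤ n} := by
    intro n
    apply Set.Finite.subset (Set.finite_Iic ((n, n, n) : ℕ × ℕ × ℕ))
    rintro ⟨i, j, l⟩ h
    simp only [degC, Set.mem_ofPred_eq] at h
    simp only [Set.mem_Iic, Prod.mk_le_mk]
    omega
  have hn : ∀ n, LinearIndependent k (fun p : {p | degC p ≤ n} => monC k p) := by
    intro n
    have := fin n
    have := Fintype.ofFinite {p | degC p ≤ n}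
    rw [linearIndependent_iff_card_le_finrank_span]
    have hb' : LinearIndependent k (fun p : {p | degC p ≤ n} => b p) :=
      hb.comp _ Subtype.val_injective
    rw [linearIndependent_iff_card_eq_finrank_span] at hb'
    rw [hb']
    have : Module.Finite k (Submodule.span k (Set.range fun p : {p | degC p ≤ n} => monC k p)) :=
      Module.Finite.span_of_finite k (Set.finite_range _)
    apply Submodule.finrank_mono
    rw [Submodule.span_le]
    rintro _ ⟨⟨p, hp⟩, rfl⟩
    have := filC_mono k hp (hd p)
    rw [filC, Set.image_eq_range] at this
    exact this
  rw [linearIndependent_iff_finset_linearIndependent]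
  intro s
  have := (hn (s.sup degC)).comp
    (fun p : s => (⟨p.1, Finset.le_sup (f := degC) p.2⟩ : {p | degC p ≤ s.sup degC})) (by
      intro p q h
      exact Subtype.ext (congrArg (fun r : {p | degC p ≤ s.sup degC} => r.1) h))
  exact this

end main

/-- PBW basis for `U(sl₂ᶜ(k))`: the monomials `a₁^i a₂^j a₃^k` form a `k`-basis;
in particular `a₁, a₂, a₃` span a 3-dimensional subspace of `U(g)`. -/
theorem stmt15 (k : Type) [Field k] [IsAlgClosed k] [CharZero k] :
    LinearIndependent k
      (fun p : ℕ × ℕ × ℕ => genC k 0 ^ p.1 * genC k 1 ^ p.2.1 * genC k 2 ^ p.2.2) ∧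
    Submodule.span k
      (Set.range fun p : ℕ × ℕ × ℕ => genC k 0 ^ p.1 * genC k 1 ^ p.2.1 * genC k 2 ^ p.2.2) =
      ⊤ ∧
    Module.finrank k ↥(Submodule.span k {genC k 0, genC k 1, genC k 2}) = 3 := by
  refine ⟨indep_mon k, span_mon k, ?_⟩
  have h := (indep_mon k).comp ![(1, 0, 0), (0, 1, 0), (0, 0, 1)] (by decide)
  have e : monC k ∘ ![(1, 0, 0), (0, 1, 0), (0, 0, 1)] = ![genC k 0, genC k 1, genC k 2] := by
    ext1 i
    fin_cases i <;> simp [monC]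
  rw [e] at h
  have h2 := finrank_span_eq_card h
  have e2 : Set.range ![genC k 0, genC k 1, genC k 2] = {genC k 0, genC k 1, genC k 2} := by
    ext a
    simp
    tauto
  rw [e2] at h2
  simpa using h2
end
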